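/- Let C be a code in H(m,q) with |C| ≥ 2 and minimum distance δ = m. Then there exists a code C' equivalent to C with C' ⊆ Rep(m,q). Moreover, if C is 1-regular then C' = Rep(m,q); and if C is 2-regular and m ≥ 4 then q = 2 and C' = Rep(m,2). -/

import Mathlib

open Equiv

namespace NT

/-- Vertices of the Hamming graph `H(m,q)`. -/
abbrev V (m q : ℕ) := Fin m → Fin q

/-- The automorphism of `H(m,q)` determined by alphabet permutations `g` and
an entry permutation `σ`:  `α ↦ (i ↦ gᵢ (α (σ⁻¹ i)))`. -/
def hAut (m q : ℕ) (g : Fin m → Perm (Fin q)) (σ : Perm (Fin m)) :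
    Perm (V m q) where
  toFun α := fun i => g i (α (σ⁻¹ i))
  invFun α := fun i => (g (σ i))⁻¹ (α (σ i))
  left_inv α := by funext i; simp
  right_inv α := by funext i; simp

/-- The automorphism group of the Hamming graph, as a subgroup of the group of
all permutations of the vertex set:  `S_q^m ⋊ S_m`. -/
def HammingAut (m q : ℕ) : Subgroup (Perm (V m q)) where
  carrier := {x | ∃ g σ, x = hAut m q g σ}
  one_mem' := ⟨fun _ => 1, 1, by ext α i; simp [hAut]⟩
  mul_mem' := by
    rintro x y ⟨g, σ, rfl⟩ ⟨h, τ, rfl⟩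
    exact ⟨fun i => g i * h (σ⁻¹ i), σ * τ, by ext α i; simp [hAut, Perm.mul_apply]⟩
  inv_mem' := by
    rintro x ⟨g, σ, rfl⟩
    refine ⟨fun i => (g (σ i))⁻¹, σ⁻¹, ?_⟩
    ext α i
    simp [hAut, Perm.inv_def]

/-- The minimum distance of a code `C ⊆ H(m,q)`. -/
noncomputable def minDist (m q : ℕ) (C : Set (V m q)) : ℕ :=
  sInf {d | ∃ α ∈ C, ∃ β ∈ C, α ≠ β ∧ hammingDist α β = d}

/-- The distance `d(α, C)` from a vertex to a code. -/
noncomputable def distTo (m q : ℕ) (C : Set (V m q)) (α : V m q) : ℕ :=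
  sInf {d | ∃ β ∈ C, hammingDist α β = d}

/-- `C_r`, the set of vertices at distance exactly `r` from the code `C`. -/
def cell (m q : ℕ) (C : Set (V m q)) (r : ℕ) : Set (V m q) :=
  {α | distTo m q C α = r}

/-- The covering radius of a code. -/
noncomputable def covRad (m q : ℕ) (C : Set (V m q)) : ℕ :=
  sSup (Set.range (distTo m q C))

/-- `S` is an orbit of the subgroup `X ≤ Sym(V)`. -/
def IsOrbit (m q : ℕ) (X : Subgroup (Perm (V m q))) (S : Set (V m q)) : Prop :=
  S.Nonempty ∧ (∀ x ∈ X, ∀ ν ∈ S, x ν ∈ S) ∧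
    ∀ ν ∈ S, ∀ μ ∈ S, ∃ x ∈ X, x ν = μ

/-- `C` is `(X,s)`-neighbour transitive:  `X` is a group of automorphisms of the
Hamming graph and each of `C, C_1, …, C_s` is an `X`-orbit. -/
def IsNT (m q : ℕ) (X : Subgroup (Perm (V m q))) (C : Set (V m q)) (s : ℕ) : Prop :=
  X ≤ HammingAut m q ∧ IsOrbit m q X C ∧
    ∀ i, 1 ≤ i → i ≤ s → IsOrbit m q X (cell m q C i)

/-- `X` acts faithfully on the set of entries, i.e. `X ∩ S_q^m = 1`. -/
def EntryFaithful (m q : ℕ) (X : Subgroup (Perm (V m q))) : Prop :=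
  ∀ x ∈ X, (∃ g, x = hAut m q g 1) → x = 1

/-- The image of `X` in `S_m` under the entry action `μ`. -/
def entryImage (m q : ℕ) (X : Subgroup (Perm (V m q))) : Set (Perm (Fin m)) :=
  {σ | ∃ x ∈ X, ∃ g, x = hAut m q g σ}

/-- Two codes are equivalent if one is the image of the other under an
automorphism of the Hamming graph. -/
def CodeEquiv (m q : ℕ) (C C' : Set (V m q)) : Prop :=
  ∃ x ∈ HammingAut m q, x '' C = C'

/-- The repetition code: all constant tuples. -/
def RepCode (m q : ℕ) : Set (V m q) := {α | ∃ a, α = fun _ => a}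

/-- The zero vertex. -/
def zeroV (m q : ℕ) [NeZero q] : V m q := fun _ => 0

/-- The weight of a vertex: the number of nonzero entries. -/
noncomputable def wt (m q : ℕ) [NeZero q] (α : V m q) : ℕ :=
  hammingNorm α

/-- `α` covers `ν` if `α` agrees with `ν` on every nonzero entry of `ν`. -/
def Covers (m q : ℕ) [NeZero q] (α ν : V m q) : Prop :=
  ∀ i, ν i ≠ 0 → ν i = α i

/-- A `q`-ary `s-(m,k,λ)` design: a set of weight-`k` vertices such that every
weight-`s` vertex is covered by exactly `λ` of them. -/
noncomputable def IsDesign (m q : ℕ) [NeZero q] (s k lam : ℕ) (D : Set (V m q)) : Prop :=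
  (∀ α ∈ D, wt m q α = k) ∧
    ∀ ν : V m q, wt m q ν = s → {α ∈ D | Covers m q α ν}.ncard = lam

/-- `C` is `s`-regular: for each `i ≤ s` and `k ≤ m`, the number
`|Γ_k(ν) ∩ C|` is the same for all `ν ∈ C_i`. -/
def SRegular (m q : ℕ) (C : Set (V m q)) (s : ℕ) : Prop :=
  ∀ i ≤ s, ∀ k ≤ m, ∀ ν ∈ cell m q C i, ∀ μ ∈ cell m q C i,
    {β ∈ C | hammingDist ν β = k}.ncard = {β ∈ C | hammingDist μ β = k}.ncard

/-- The automorphism group of a code: the setwise stabiliser of `C` in the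
automorphism group of the Hamming graph. -/
def AutCode (m q : ℕ) (C : Set (V m q)) : Subgroup (Perm (V m q)) where
  carrier := {x | x ∈ HammingAut m q ∧ x '' C = C}
  one_mem' := ⟨(HammingAut m q).one_mem, by simp⟩
  mul_mem' := by
    rintro x y ⟨hx, hx'⟩ ⟨hy, hy'⟩
    exact ⟨mul_mem hx hy, by rw [Perm.coe_mul, Set.image_comp, hy', hx']⟩
  inv_mem' := by
    rintro x ⟨hx, hx'⟩
    refine ⟨inv_mem hx, ?_⟩
    conv_lhs => rw [← hx']
    rw [← Set.image_comp]
    simp [Perm.inv_def]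

/-- `N` is a minimal normal subgroup of the (sub)group `H`. -/
def IsMinNormalIn {G : Type*} [Group G] (H N : Subgroup G) : Prop :=
  N ≤ H ∧ N ≠ ⊥ ∧ (∀ h ∈ H, ∀ n ∈ N, h * n * h⁻¹ ∈ N) ∧
    ∀ K : Subgroup G, K ≤ H → K ≠ ⊥ →
      (∀ h ∈ H, ∀ k ∈ K, h * k * h⁻¹ ∈ K) → K ≤ N → K = N

/-- The socle of a subgroup `H`: the subgroup generated by all minimal
normal subgroups of `H`. -/
def socleIn {G : Type*} [Group G] (H : Subgroup G) : Subgroup G :=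
  ⨆ N ∈ {N : Subgroup G | IsMinNormalIn H N}, N

/-- A row of the punctured Hadamard 12 code: the binary vector whose entry at
`a ∈ F₁₁` is `1` exactly when `a - b` is a square in `F₁₁` (including `0`),
corresponding to the translate by `b` of the first row of the normalised Paley
Hadamard matrix of order 12 (with the `*` coordinate deleted, and with the
Hadamard entry `-1` encoded as `1`, `1` as `0`). -/
def hadRow (b : ZMod 11) : V 11 2 :=
  fun i => if ∃ c : ZMod 11, c ^ 2 = ((i : ℕ) : ZMod 11) - b then 1 else 0

/-- The punctured Hadamard code of length 12 in `H(11,2)`: the zero vector and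
all-ones vector (from the all-`(-1)` row of `-H₁₂` and of `H₁₂`), the eleven
weight-6 rows `hadRow b`, and their complements (the rows of `-H₁₂`). -/
def PHad : Set (V 11 2) :=
  {(fun _ => 0), (fun _ => 1)} ∪ Set.range hadRow ∪
    Set.range (fun b => (fun i => 1 - hadRow b i : V 11 2))

/-- The even weight subcode of the punctured Hadamard code of length 12: the
zero vector together with the eleven weight-6 codewords. -/
def ESub : Set (V 11 2) :=
  insert (fun _ => 0) (Set.range hadRow)

end NT

namespace NT

variable {m q : ℕ} {C : Set (V m q)}

lemma hammingDist_hAut (g : Fin m → Perm (Fin q)) (σ : Perm (Fin m)) (α β : V m q) :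
    hammingDist (hAut m q g σ α) (hAut m q g σ β) = hammingDist α β := by
  unfold hammingDist
  refine Finset.card_bij (fun i _ => σ⁻¹ i) ?_ ?_ ?_
  · intro i hi
    simpa [hAut] using hi
  · intro i _ j _ h
    exact σ⁻¹.injective h
  · intro j hj
    exact ⟨σ j, by simpa [hAut] using hj, by simp⟩

lemma distTo_image {x : Perm (V m q)}
    (hx : ∀ α β, hammingDist (x α) (x β) = hammingDist α β) (C : Set (V m q)) (α : V m q) :
    distTo m q (x '' C) (x α) = distTo m q C α := by
  simp only [distTo, Set.exists_mem_image, hx]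

lemma sep_hammingDist_image {x : Perm (V m q)}
    (hx : ∀ α β, hammingDist (x α) (x β) = hammingDist α β) (C : Set (V m q)) (ν : V m q)
    (k : ℕ) :
    {β ∈ x '' C | hammingDist (x ν) β = k} = x '' {β ∈ C | hammingDist ν β = k} := by
  ext β
  constructor
  · rintro ⟨⟨γ, hγ, rfl⟩, h⟩
    exact ⟨γ, ⟨hγ, by rwa [hx] at h⟩, rfl⟩
  · rintro ⟨γ, ⟨hγ, h⟩, rfl⟩
    exact ⟨⟨γ, hγ, rfl⟩, by rwa [hx]⟩

lemma SRegular.image {s : ℕ} (h : SRegular m q C s) {x : Perm (V m q)}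
    (hx : ∀ α β, hammingDist (x α) (x β) = hammingDist α β) : SRegular m q (x '' C) s := by
  intro i hi k hk ν hν μ hμ
  obtain ⟨ν, rfl⟩ := x.surjective ν
  obtain ⟨μ, rfl⟩ := x.surjective μ
  simp only [cell, Set.mem_ofPred_eq, distTo_image hx] at hν hμ
  rw [sep_hammingDist_image hx, sep_hammingDist_image hx,
    Set.ncard_image_of_injective _ x.injective, Set.ncard_image_of_injective _ x.injective]
  exact h i hi k hk ν hν μ hμ

lemma SRegular.mono {s t : ℕ} (h : SRegular m q C t) (hst : s ≤ t) : SRegular m q C s :=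
  fun i hi => h i (hi.trans hst)

lemma hammingDist_eq_iff_forall_ne {α β : V m q} :
    hammingDist α β = m ↔ ∀ i, α i ≠ β i := by
  have h := Finset.card_filter_eq_iff (s := (Finset.univ : Finset (Fin m)))
    (p := fun i => α i ≠ β i)
  rw [Finset.card_univ, Fintype.card_fin] at h
  simpa [hammingDist] using h

lemma apply_ne_of_minDist_eq (hδ : minDist m q C = m) {α β : V m q} (hα : α ∈ C) (hβ : β ∈ C)
    (hne : α ≠ β) (i : Fin m) : α i ≠ β i := by
  have h₁ : m ≤ hammingDist α β :=
    hδ.symm.le.trans (Nat.sInf_le ⟨α, hα, β, hβ, hne, rfl⟩)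
  have h₂ : hammingDist α β ≤ m := by
    simpa using hammingDist_le_card_fintype (x := α) (y := β)
  exact hammingDist_eq_iff_forall_ne.1 (h₂.antisymm h₁) i

/-- A code in which distinct codewords differ in every entry can be moved into the repetition
code by permuting the alphabet in each entry. -/
lemma exists_hAut_image_subset_repCode (i₀ : Fin m)
    (h : ∀ α ∈ C, ∀ β ∈ C, α ≠ β → ∀ i, α i ≠ β i) :
    ∃ g : Fin m → Perm (Fin q), hAut m q g 1 '' C ⊆ RepCode m q := by
  classical
  have hinj : ∀ i, Function.Injective (fun α : C => α.1 i) := by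
    intro i α β hαβ
    by_contra hne
    exact h α α.2 β β.2 (fun e => hne (Subtype.ext e)) i hαβ
  let e (i : Fin m) : {a // a ∈ Set.range fun α : C => α.1 i} ≃
      {a // a ∈ Set.range fun α : C => α.1 i₀} :=
    (Equiv.ofInjective _ (hinj i)).symm.trans (Equiv.ofInjective _ (hinj i₀))
  refine ⟨fun i => (e i).extendSubtype, ?_⟩
  rintro _ ⟨α, hα, rfl⟩
  refine ⟨α i₀, funext fun i => ?_⟩
  change (e i).extendSubtype (α i) = α i₀
  rw [Equiv.extendSubtype_apply_of_mem (e i) (α i) ⟨⟨α, hα⟩, rfl⟩]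
  have : (Equiv.ofInjective _ (hinj i)).symm ⟨α i, ⟨⟨α, hα⟩, rfl⟩⟩ = ⟨α, hα⟩ := by
    rw [Equiv.symm_apply_eq]
    rfl
  simp [e, this]

lemma distTo_eq {r : ℕ} {ν β : V m q} (hβ : β ∈ C) (hr : hammingDist ν β = r)
    (h : ∀ γ ∈ C, r ≤ hammingDist ν γ) : distTo m q C ν = r := by
  refine le_antisymm (Nat.sInf_le ⟨β, hβ, hr⟩) (le_csInf ⟨r, β, hβ, hr⟩ ?_)
  rintro _ ⟨γ, hγ, rfl⟩
  exact h γ hγ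

/-- The vertex with entries `b` at `i` and `a` elsewhere lies at distance one from any subcode
of the repetition code containing the constant tuple `a`. -/
lemma update_mem_cell_one (hsub : C ⊆ RepCode m q) {i j : Fin m} (hij : i ≠ j) {a b : Fin q}
    (hab : a ≠ b) (ha : (fun _ => a) ∈ C) :
    Function.update (fun _ => a) i b ∈ cell m q C 1 := by
  refine distTo_eq ha ?_ ?_
  · rw [hammingDist, Finset.card_eq_one]
    refine ⟨i, Finset.ext fun k => ?_⟩
    by_cases hk : k = i
    · simp [hk, hab.symm]
    · simp [hk]
  · intro γ hγ
    obtain ⟨c, rfl⟩ := hsub hγ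
    rw [Nat.one_le_iff_ne_zero, hammingDist_ne_zero]
    intro he
    have h₁ := congrFun he i
    have h₂ := congrFun he j
    simp only [Function.update_self, Function.update_of_ne hij.symm] at h₁ h₂
    exact hab (h₂.trans h₁.symm)

lemma update_update_mem_cell_two (hsub : C ⊆ RepCode m q) {i j k l : Fin m} (hij : i ≠ j)
    (hik : i ≠ k) (hil : i ≠ l) (hjk : j ≠ k) (hjl : j ≠ l) (hkl : k ≠ l) {a b c : Fin q}
    (hab : a ≠ b) (hac : a ≠ c) (ha : (fun _ => a) ∈ C) :
    Function.update (Function.update (fun _ => a) i b) j c ∈ cell m q C 2 := by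
  refine distTo_eq ha ?_ ?_
  · rw [hammingDist, Finset.card_eq_two]
    refine ⟨i, j, hij, Finset.ext fun n => ?_⟩
    by_cases hj : n = j
    · simp [hj, hac.symm]
    · by_cases hi : n = i
      · subst hi
        simp [hj, hab.symm]
      · simp [hj, hi]
  · intro γ hγ
    obtain ⟨d, rfl⟩ := hsub hγ
    by_cases had : a = d
    · subst had
      rw [← Finset.card_pair hij]
      refine Finset.card_le_card fun n hn => ?_
      rcases Finset.mem_insert.1 hn with rfl | hn
      · simp [hij, hab.symm]
      · rw [Finset.mem_singleton.1 hn]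
        simp [hac.symm]
    · rw [← Finset.card_pair hkl]
      refine Finset.card_le_card fun n hn => ?_
      rcases Finset.mem_insert.1 hn with rfl | hn
      · simp [hik.symm, hjk.symm, had]
      · rw [Finset.mem_singleton.1 hn]
        simp [hil.symm, hjl.symm, had]

/-- In a regular subcode of the repetition code, if the codeword symbols occurring in a vertex `μ`
all occur in a vertex `ν` of the same cell, then both vertices use the same codeword symbols. -/
lemma SRegular.mem_range_of_range_subset {s r : ℕ} (h : SRegular m q C s) (hr : r ≤ s)
    (hsub : C ⊆ RepCode m q) {ν μ : V m q} (hν : ν ∈ cell m q C r) (hμ : μ ∈ cell m q C r)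
    (hrange : ∀ d, (fun _ => d) ∈ C → d ∈ Set.range μ → d ∈ Set.range ν)
    {b : Fin q} (hb : (fun _ => b) ∈ C) (hbν : b ∈ Set.range ν) : b ∈ Set.range μ := by
  by_contra hbμ
  refine (Set.ncard_lt_ncard ?_ (Set.toFinite _)).ne (h r hr m le_rfl ν hν μ hμ)
  simp only [hammingDist_eq_iff_forall_ne]
  rw [Set.ssubset_iff_of_subset]
  · refine ⟨fun _ => b, ⟨hb, fun i hi => hbμ ⟨i, hi⟩⟩, ?_⟩
    obtain ⟨i, hi⟩ := hbν
    exact fun hmem => hmem.2 i hi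
  · rintro γ ⟨hγ, hne⟩
    obtain ⟨d, rfl⟩ := hsub hγ
    refine ⟨hγ, fun i hi => ?_⟩
    obtain ⟨j, hj⟩ := hrange d hγ ⟨i, hi⟩
    exact hne j hj

lemma SRegular.eq_repCode (h : SRegular m q C 1) (hm : 2 ≤ m) (hsub : C ⊆ RepCode m q)
    (hC : 2 ≤ C.ncard) : C = RepCode m q := by
  obtain ⟨α, hα, β, hβ, hne⟩ := (Set.one_lt_ncard (Set.toFinite C)).1 hC
  obtain ⟨a, rfl⟩ := hsub hα
  obtain ⟨b, rfl⟩ := hsub hβ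
  have hab : a ≠ b := by
    rintro rfl
    exact hne rfl
  refine hsub.antisymm ?_
  rintro _ ⟨c, rfl⟩
  by_contra hc
  have hac : a ≠ c := by
    rintro rfl
    exact hc hα
  have hbc : b ≠ c := by
    rintro rfl
    exact hc hβ
  let i : Fin m := ⟨0, by omega⟩
  let j : Fin m := ⟨1, by omega⟩
  have hij : i ≠ j := by simp [i, j]
  obtain ⟨k, hk⟩ := h.mem_range_of_range_subset le_rfl hsub
    (update_mem_cell_one hsub hij hab hα) (update_mem_cell_one hsub hij hac hα)
    (by
      rintro d hd ⟨k, hk⟩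
      by_cases hki : k = i
      · subst hki
        rw [Function.update_self] at hk
        exact absurd (hk ▸ hd) hc
      · rw [Function.update_of_ne hki] at hk
        exact ⟨k, by rwa [Function.update_of_ne hki]⟩)
    hβ ⟨i, Function.update_self ..⟩
  by_cases hki : k = i
  · subst hki
    rw [Function.update_self] at hk
    exact hbc hk.symm
  · rw [Function.update_of_ne hki] at hk
    exact hab hk

lemma SRegular.alphabet_le_two (h : SRegular m q (RepCode m q) 2) (hm : 4 ≤ m) : q ≤ 2 := by
  by_contra! hq
  let a : Fin q := ⟨0, by omega⟩
  let b : Fin q := ⟨1, by omega⟩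
  let c : Fin q := ⟨2, by omega⟩
  have hab : a ≠ b := by simp [a, b]
  have hac : a ≠ c := by simp [a, c]
  have hbc : b ≠ c := by simp [b, c]
  let i : Fin m := ⟨0, by omega⟩
  let j : Fin m := ⟨1, by omega⟩
  let k : Fin m := ⟨2, by omega⟩
  let l : Fin m := ⟨3, by omega⟩
  have hij : i ≠ j := by simp [i, j]
  have hcell {c : Fin q} (hac : a ≠ c) :
      Function.update (Function.update (fun _ => a) i b) j c ∈ cell m q (RepCode m q) 2 :=
    update_update_mem_cell_two (k := k) (l := l) subset_rfl hij (by simp [i, k])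
      (by simp [i, l]) (by simp [j, k]) (by simp [j, l]) (by simp [k, l]) hab hac ⟨a, rfl⟩
  obtain ⟨n, hn⟩ := h.mem_range_of_range_subset le_rfl subset_rfl (hcell hac) (hcell hab)
    (by
      rintro d - ⟨n, hn⟩
      by_cases hnj : n = j
      · subst hnj
        rw [Function.update_self] at hn
        exact ⟨i, by simpa [hij] using hn⟩
      · rw [Function.update_of_ne hnj] at hn
        exact ⟨n, by rwa [Function.update_of_ne hnj]⟩)
    ⟨c, rfl⟩ ⟨j, Function.update_self ..⟩
  by_cases hnj : n = j
  · subst hnj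
    rw [Function.update_self] at hn
    exact hbc hn
  · rw [Function.update_of_ne hnj] at hn
    by_cases hni : n = i
    · subst hni
      rw [Function.update_self] at hn
      exact hbc hn
    · rw [Function.update_of_ne hni] at hn
      exact hac hn

end NT

open NT Equiv in
/-- Lemma 2.15: a code with `|C| ≥ 2` and `δ = m` is equivalent to a
subcode `C'` of the repetition code; if `C` is 1-regular then `C' = Rep(m,q)`, and
if `C` is 2-regular and `m ≥ 4` then `q = 2` and `C' = Rep(m,2)`. -/
theorem stmt_10 (m q : ℕ) (hm : 2 ≤ m) (hq : 2 ≤ q)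
    (C : Set (V m q)) (hC : 2 ≤ C.ncard) (hδ : minDist m q C = m) :
    ∃ C' : Set (V m q), CodeEquiv m q C C' ∧ C' ⊆ RepCode m q ∧
      (SRegular m q C 1 → C' = RepCode m q) ∧
      (SRegular m q C 2 → 4 ≤ m → q = 2 ∧ C' = RepCode m q) := by
  obtain ⟨g, hg⟩ := exists_hAut_image_subset_repCode (⟨0, by omega⟩ : Fin m)
    (fun α hα β hβ hne i => apply_ne_of_minDist_eq hδ hα hβ hne i)
  have hreg {s : ℕ} (h : SRegular m q C s) : SRegular m q (hAut m q g 1 '' C) s :=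
    h.image (hammingDist_hAut g 1)
  have hcard : 2 ≤ (hAut m q g 1 '' C).ncard := by
    rwa [Set.ncard_image_of_injective _ (hAut m q g 1).injective]
  refine ⟨hAut m q g 1 '' C, ⟨_, ⟨g, 1, rfl⟩, rfl⟩, hg,
    fun h => (hreg h).eq_repCode hm hg hcard, fun h hm4 => ?_⟩
  have hrep := ((hreg h).mono one_le_two).eq_repCode hm hg hcard
  exact ⟨(SRegular.alphabet_le_two (hrep ▸ hreg h) hm4).antisymm hq, hrep⟩
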